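/- arXiv:2011.06989 — 8 statements merged into one kernel-verified Lean document; each statement's English description precedes it below -/
import Mathlib

section
/- Let R be a commutative ring, I a finitely generated ideal of R, M any R-module and N an I-adically complete R-module. Then precomposition with the canonical map γ_M : M → M^∧_I is a bijection from the set of R-linear maps M^∧_I → N to the set of R-linear maps M → N. (In other words, I-adic completion is left adjoint to the inclusion of I-adically complete modules into all R-modules.) -/
/-- When `I` is finitely generated, two linear maps from `AdicCompletion I M` to an `I`-adically
separated module agree as soon as they agree on the image of `M`. -/
theorem AdicCompletion.linearMap_ext_of_fg {R : Type*} [CommRing R] {I : Ideal R} (hI : I.FG)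
    {M N : Type*} [AddCommGroup M] [Module R M] [AddCommGroup N] [Module R N] [IsHausdorff I N]
    {g₁ g₂ : AdicCompletion I M →ₗ[R] N}
    (h : g₁.comp (AdicCompletion.of I M) = g₂.comp (AdicCompletion.of I M)) : g₁ = g₂ := by
  refine LinearMap.ext fun x => ?_
  rw [← sub_eq_zero, ← LinearMap.sub_apply]
  refine IsHausdorff.haus ‹_› _ fun n => ?_
  obtain ⟨m, hm⟩ := Submodule.mkQ_surjective _ (AdicCompletion.eval I M n x)
  have hx : x - AdicCompletion.of I M m ∈ I ^ n • (⊤ : Submodule R (AdicCompletion I M)) := by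
    rw [AdicCompletion.pow_smul_top_eq_ker_eval hI, LinearMap.mem_ker, map_sub,
      AdicCompletion.eval_of, hm, sub_self]
  have hm0 : (g₁ - g₂) (AdicCompletion.of I M m) = 0 :=
    sub_eq_zero.mpr (LinearMap.congr_fun h m)
  have key := Submodule.mem_map_of_mem (f := g₁ - g₂) hx
  rw [map_sub, hm0, sub_zero, Submodule.map_smul''] at key
  exact SModEq.zero.mpr (Submodule.smul_mono le_rfl le_top key)

/-- Let `R` be a commutative ring, `I` a finitely generated ideal of `R`,
`M` any `R`-module and `N` an `I`-adically complete `R`-module. Then precomposition with the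
canonical map `γ_M : M → M^∧_I` is a bijection from the set of `R`-linear maps `M^∧_I → N`
to the set of `R`-linear maps `M → N`. -/
theorem adicCompletion_adjunction {R : Type*} [CommRing R] (I : Ideal R) (hI : I.FG)
    (M N : Type*) [AddCommGroup M] [Module R M] [AddCommGroup N] [Module R N]
    [IsAdicComplete I N] :
    Function.Bijective
      (fun g : AdicCompletion I M →ₗ[R] N => g.comp (AdicCompletion.of I M)) := by
  refine ⟨fun _ _ h => AdicCompletion.linearMap_ext_of_fg hI h, fun f =>
    ⟨(AdicCompletion.ofLinearEquiv I N).symm.toLinearMap ∘ₗ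
      (AdicCompletion.map I f).restrictScalars R, ?_⟩⟩
  ext m
  simp [AdicCompletion.map_of]
end

section
/- Let R be a commutative ring, I a finitely generated ideal of R, and M, N R-modules. If N is I-adically complete, then the R-module Hom_R(M, N) of R-linear maps from M to N is I-adically complete, i.e. IsAdicComplete I (M →ₗ[R] N) holds. -/
theorem SModEq.map_smul_top {R : Type*} [CommRing R] {J : Ideal R} {M N : Type*}
    [AddCommGroup M] [Module R M] [AddCommGroup N] [Module R N] (f : M →ₗ[R] N) {x y : M}
    (hxy : x ≡ y [SMOD (J • ⊤ : Submodule R M)]) :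
    f x ≡ f y [SMOD (J • ⊤ : Submodule R N)] :=
  (hxy.map f).mono (Submodule.map_le_iff_le_comap.mpr
    (Submodule.smul_top_le_comap_smul_top J f))

/-- A linear retract of an `I`-adically complete module is `I`-adically complete. -/
theorem IsAdicComplete.of_leftInverse {R : Type*} [CommRing R] (I : Ideal R) {M N : Type*}
    [AddCommGroup M] [Module R M] [AddCommGroup N] [Module R N] [IsAdicComplete I N]
    (i : M →ₗ[R] N) (r : N →ₗ[R] M) (h : Function.LeftInverse r i) :
    IsAdicComplete I M := by
  refine { haus' := fun x hx ↦ ?_, prec' := fun f hf ↦ ?_ }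
  · apply h.injective
    rw [map_zero]
    refine IsHausdorff.haus (I := I) inferInstance _ fun n ↦ ?_
    simpa only [map_zero] using SModEq.map_smul_top i (hx n)
  · obtain ⟨L, hL⟩ := IsPrecomplete.prec (I := I) inferInstance
      (f := fun n ↦ i (f n)) fun hmn ↦ SModEq.map_smul_top i (hf hmn)
    exact ⟨r L, fun n ↦ by simpa only [h (f n)] using SModEq.map_smul_top r (hL n)⟩

namespace AdicCompletion

/-- The linear map on the completion of `M →ₗ[R] N` that sends a compatible family of linear
maps to its pointwise limit. -/
noncomputable def linearMapPointwise {R : Type*} [CommRing R] (I : Ideal R) (M N : Type*)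
    [AddCommGroup M] [Module R M] [AddCommGroup N] [Module R N] :
    AdicCompletion I (M →ₗ[R] N) →ₗ[R] M →ₗ[R] AdicCompletion I N :=
  LinearMap.mk₂ R (fun x m ↦ map I (LinearMap.applyₗ m) x)
    (fun _ _ _ ↦ map_add _ _ _)
    (fun c x m ↦ ((map I (LinearMap.applyₗ m)).restrictScalars R).map_smul c x)
    (fun x m₁ m₂ ↦ by
      induction x using induction_on with | h f
      ext n
      simp)
    (fun c x m ↦ by
      induction x using induction_on with | h f
      ext n
      simp [val_smul_apply])

@[simp]
theorem linearMapPointwise_of {R : Type*} [CommRing R] (I : Ideal R) {M N : Type*}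
    [AddCommGroup M] [Module R M] [AddCommGroup N] [Module R N] (f : M →ₗ[R] N) (m : M) :
    linearMapPointwise I M N (of I _ f) m = of I N (f m) :=
  map_of I (LinearMap.applyₗ m) f

end AdicCompletion

/-- Let `R` be a commutative ring, `I` a finitely generated ideal of `R`,
and `M`, `N` `R`-modules. If `N` is `I`-adically complete, then the `R`-module
`Hom_R(M, N)` of `R`-linear maps from `M` to `N` is `I`-adically complete. -/
theorem isAdicComplete_linearMap {R : Type*} [CommRing R] (I : Ideal R) (hI : I.FG)
    (M N : Type*) [AddCommGroup M] [Module R M] [AddCommGroup N] [Module R N]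
    [IsAdicComplete I N] :
    IsAdicComplete I (M →ₗ[R] N) := by
  have := AdicCompletion.isAdicComplete (M := M →ₗ[R] N) hI
  refine IsAdicComplete.of_leftInverse I (AdicCompletion.of I (M →ₗ[R] N))
    ((AdicCompletion.ofLinearEquiv I N).symm.toLinearMap.compRight R ∘ₗ
      AdicCompletion.linearMapPointwise I M N) fun f ↦ ?_
  ext m
  simp
end

section
/- Let R be a commutative ring, I a finitely generated ideal of R, and M, N R-modules. The R-linear map (M ⊗_R N)^∧_I → (M^∧_I ⊗_R N)^∧_I obtained by applying I-adic completion to the map γ_M ⊗ id_N : M ⊗_R N → M^∧_I ⊗_R N is an isomorphism. -/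
namespace AdicCompletion

variable {R : Type*} [CommRing R] (I : Ideal R)

open scoped TensorProduct

theorem map_bijective_of_reduceModIdeal_bijective {P Q : Type*} [AddCommGroup P] [Module R P]
    [AddCommGroup Q] [Module R Q] (f : P →ₗ[R] Q)
    (hf : ∀ n, Function.Bijective (LinearMap.reduceModIdeal (I ^ n) f)) :
    Function.Bijective (map I f) := by
  refine ⟨fun x y h ↦ ext fun n ↦ (hf n).1 ?_, fun y ↦ ?_⟩
  · rw [← map_val_apply, ← map_val_apply, h]
  · choose x hx using fun n ↦ (hf n).2 (y.val n)
    refine ⟨⟨x, fun {m n} hmn ↦ (hf m).1 ?_⟩, ext hx⟩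
    have h := LinearMap.congr_fun (transitionMap_comp_reduceModIdeal I f hmn) (x n)
    refine h.symm.trans ((congrArg (transitionMap I Q hmn) (hx n)).trans ?_)
    exact (y.prop hmn).trans (hx m).symm

variable (M N : Type*) [AddCommGroup M] [Module R M] [AddCommGroup N] [Module R N]

/-- The map `M^∧_I ⊗ N → (M ⊗ N) / Iⁿ (M ⊗ N)` induced by the projection `M^∧_I → M / Iⁿ M`. -/
noncomputable def evalTensor (n : ℕ) :
    AdicCompletion I M ⊗[R] N →ₗ[R] (M ⊗[R] N) ⧸ (I ^ n • ⊤ : Submodule R (M ⊗[R] N)) :=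
  TensorProduct.lift <|
    (Submodule.liftQ (I ^ n • ⊤ : Submodule R M)
      ((TensorProduct.mk R M N).compr₂ (I ^ n • ⊤ : Submodule R (M ⊗[R] N)).mkQ) <| by
        rw [Submodule.smul_le]
        intro r hr m _
        ext y
        refine (Submodule.Quotient.mk_eq_zero _).2 ?_
        rw [map_smul, LinearMap.smul_apply]
        exact Submodule.smul_mem_smul hr Submodule.mem_top) ∘ₗ
    eval I M n

theorem evalTensor_comp_rTensor_of (n : ℕ) :
    evalTensor I M N n ∘ₗ LinearMap.rTensor N (of I M) = Submodule.mkQ _ := by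
  ext m y
  simp [evalTensor]

variable {I} in
theorem reduceModIdeal_rTensor_of_bijective (hI : I.FG) (n : ℕ) :
    Function.Bijective (LinearMap.reduceModIdeal (I ^ n) (LinearMap.rTensor N (of I M))) := by
  constructor
  · rw [injective_iff_map_eq_zero]
    intro x hx
    obtain ⟨x, rfl⟩ := Submodule.mkQ_surjective _ x
    have hx' : LinearMap.rTensor N (of I M) x ∈
        (I ^ n • ⊤ : Submodule R (AdicCompletion I M ⊗[R] N)) := by
      simpa using hx
    have hle : (I ^ n • ⊤ : Submodule R (AdicCompletion I M ⊗[R] N)) ≤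
        (evalTensor I M N n).ker := by
      rw [Submodule.smul_le]
      intro r hr z _
      obtain ⟨w, hw⟩ := Submodule.mkQ_surjective _ (evalTensor I M N n z)
      rw [LinearMap.mem_ker, map_smul, ← hw, ← map_smul, Submodule.mkQ_apply,
        Submodule.Quotient.mk_eq_zero]
      exact Submodule.smul_mem_smul hr Submodule.mem_top
    have h := hle hx'
    rwa [LinearMap.mem_ker, ← LinearMap.comp_apply, evalTensor_comp_rTensor_of] at h
  · rw [← LinearMap.range_eq_top, eq_top_iff]
    rintro z -
    obtain ⟨z, rfl⟩ := Submodule.mkQ_surjective _ z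
    induction z with
    | zero => simp
    | add a b ha hb => rw [map_add]; exact add_mem ha hb
    | tmul a y =>
      obtain ⟨m, hm⟩ := Submodule.mkQ_surjective _ (eval I M n a)
      refine ⟨Submodule.mkQ _ (m ⊗ₜ[R] y), ?_⟩
      have hker : of I M m - a ∈ (I ^ n • ⊤ : Submodule R (AdicCompletion I M)) := by
        rw [pow_smul_top_eq_ker_eval hI, LinearMap.mem_ker, map_sub, eval_of, hm, sub_self]
      have hmap : (I ^ n • ⊤ : Submodule R (AdicCompletion I M)) ≤
          (I ^ n • ⊤ : Submodule R (AdicCompletion I M ⊗[R] N)).comap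
            ((TensorProduct.mk R _ N).flip y) :=
        Submodule.smul_top_le_comap_smul_top _ _
      have h := hmap hker
      rw [Submodule.mkQ_apply, LinearMap.reduceModIdeal_apply, LinearMap.rTensor_tmul,
        Submodule.mkQ_apply, Submodule.Quotient.eq, ← TensorProduct.sub_tmul]
      exact h

end AdicCompletion


/-- Let `R` be a commutative ring, `I` a finitely generated ideal of `R`,
and `M`, `N` `R`-modules. The `R`-linear map `(M ⊗_R N)^∧_I → (M^∧_I ⊗_R N)^∧_I` obtained
by applying `I`-adic completion to `γ_M ⊗ id_N : M ⊗_R N → M^∧_I ⊗_R N` is an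
isomorphism. -/
theorem adicCompletion_tensor_completion_left {R : Type*} [CommRing R] (I : Ideal R)
    (hI : I.FG) (M N : Type*) [AddCommGroup M] [Module R M] [AddCommGroup N] [Module R N] :
    Function.Bijective
      (AdicCompletion.map I (LinearMap.rTensor N (AdicCompletion.of I M))) := by
  exact AdicCompletion.map_bijective_of_reduceModIdeal_bijective I _
    (AdicCompletion.reduceModIdeal_rTensor_of_bijective M N hI)
end

section
/- Let R be a commutative ring, I a finitely generated ideal of R, and M, N R-modules. The R-linear map (M ⊗_R N)^∧_I → (M^∧_I ⊗_R N^∧_I)^∧_I obtained by applying I-adic completion to the map γ_M ⊗ γ_N : M ⊗_R N → M^∧_I ⊗_R N^∧_I is an isomorphism. -/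
open scoped TensorProduct

namespace AdicCompletion

variable {R : Type*} [CommRing R] (I : Ideal R)
variable {M N : Type*} [AddCommGroup M] [Module R M] [AddCommGroup N] [Module R N]

theorem map_injective_of_comap_pow_smul_top_le {f : M →ₗ[R] N}
    (hf : ∀ n, (I ^ n • ⊤ : Submodule R N).comap f ≤ I ^ n • ⊤) :
    Function.Injective (map I f) := by
  rw [injective_iff_map_eq_zero]
  intro x hx
  ext n
  obtain ⟨m, hm⟩ := Submodule.mkQ_surjective _ (x.val n)
  have h : (map I f x).val n = 0 := by rw [hx]; rfl
  rw [map_val_apply, ← hm] at h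
  rw [Submodule.mkQ_apply, LinearMap.reduceModIdeal_apply, Submodule.Quotient.mk_eq_zero] at h
  rw [← hm]
  exact (Submodule.Quotient.mk_eq_zero _).2 (hf n h)

variable (M N) in
/-- The map `M^∧ ⊗ N^∧ → (M ⊗ N) / Iⁿ (M ⊗ N)` induced by the evaluations at level `n`. -/
noncomputable def tensorEval (n : ℕ) : AdicCompletion I M ⊗[R] AdicCompletion I N →ₗ[R]
    (M ⊗[R] N) ⧸ (I ^ n • ⊤ : Submodule R (M ⊗[R] N)) :=
  Submodule.factor (sup_le
      (by
        rintro _ ⟨t, rfl⟩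
        induction t with
        | zero => simp
        | add a b ha hb => rw [_root_.map_add]; exact add_mem ha hb
        | tmul a b =>
          obtain ⟨a, ha⟩ := a
          exact Submodule.smul_top_le_comap_smul_top (I ^ n) ((TensorProduct.mk R M N).flip b) ha)
      (by
        rintro _ ⟨t, rfl⟩
        induction t with
        | zero => simp
        | add a b ha hb => rw [_root_.map_add]; exact add_mem ha hb
        | tmul a b =>
          obtain ⟨b, hb⟩ := b
          exact Submodule.smul_top_le_comap_smul_top (I ^ n) (TensorProduct.mk R M N a) hb)) ∘ₗ
    (TensorProduct.quotientTensorQuotientEquiv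
      (I ^ n • ⊤ : Submodule R M) (I ^ n • ⊤ : Submodule R N)).toLinearMap ∘ₗ
    TensorProduct.map (eval I M n) (eval I N n)

theorem tensorEval_comp_map_of (n : ℕ) :
    tensorEval I M N n ∘ₗ TensorProduct.map (of I M) (of I N) = Submodule.mkQ _ := by
  ext a b
  rfl

theorem comap_map_of_pow_smul_top_le (n : ℕ) :
    (I ^ n • ⊤ : Submodule R (AdicCompletion I M ⊗[R] AdicCompletion I N)).comap
      (TensorProduct.map (of I M) (of I N)) ≤ I ^ n • ⊤ := by
  intro x hx
  have h := Submodule.smul_top_le_comap_smul_top (I ^ n) (tensorEval I M N n) hx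
  rw [Submodule.mem_comap, ← LinearMap.comp_apply, tensorEval_comp_map_of] at h
  have h_bot : (I ^ n • ⊤ : Submodule R
      ((M ⊗[R] N) ⧸ (I ^ n • ⊤ : Submodule R (M ⊗[R] N)))) = ⊥ := by
    rw [← Submodule.range_mkQ (I ^ n • ⊤ : Submodule R (M ⊗[R] N)), LinearMap.range_eq_map,
      ← Submodule.map_smul'', Submodule.mkQ_map_self]
  rw [h_bot] at h
  exact (Submodule.Quotient.mk_eq_zero _).1 h

theorem exists_sub_of_mem_smul_top (hI : I.FG) (x : AdicCompletion I M) :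
    ∃ m, x - of I M m ∈ (I • ⊤ : Submodule R (AdicCompletion I M)) := by
  obtain ⟨m, hm⟩ := Submodule.mkQ_surjective _ (eval I M 1 x)
  refine ⟨m, ?_⟩
  have h : x - of I M m ∈ (eval I M 1).ker := by
    rw [LinearMap.mem_ker, _root_.map_sub, eval_of, hm, sub_self]
  rwa [← pow_smul_top_eq_ker_eval hI, pow_one] at h

theorem mkQ_comp_map_of_surjective (hI : I.FG) :
    Function.Surjective (Submodule.mkQ
      (I • ⊤ : Submodule R (AdicCompletion I M ⊗[R] AdicCompletion I N)) ∘ₗ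
        TensorProduct.map (of I M) (of I N)) := by
  rw [← LinearMap.range_eq_top, eq_top_iff, ← Submodule.range_mkQ, LinearMap.range_le_iff_comap,
    eq_top_iff]
  refine (TensorProduct.span_tmul_eq_top R _ _).ge.trans (Submodule.span_le.2 ?_)
  rintro _ ⟨x, y, rfl⟩
  obtain ⟨m, hm⟩ := exists_sub_of_mem_smul_top I hI x
  obtain ⟨n, hn⟩ := exists_sub_of_mem_smul_top I hI y
  refine ⟨m ⊗ₜ n, ((Submodule.Quotient.eq _).2 ?_).symm⟩
  have hx := Submodule.smul_top_le_comap_smul_top I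
    ((TensorProduct.mk R (AdicCompletion I M) (AdicCompletion I N)).flip y) hm
  have hy := Submodule.smul_top_le_comap_smul_top I
    (TensorProduct.mk R (AdicCompletion I M) (AdicCompletion I N) (of I M m)) hn
  rw [Submodule.mem_comap, LinearMap.flip_apply, TensorProduct.mk_apply,
    TensorProduct.sub_tmul] at hx
  rw [Submodule.mem_comap, TensorProduct.mk_apply, TensorProduct.tmul_sub] at hy
  rw [TensorProduct.map_tmul, ← sub_add_sub_cancel _ (of I M m ⊗ₜ y)]
  exact add_mem hx hy

end AdicCompletion

/-- Let `R` be a commutative ring, `I` a finitely generated ideal of `R`,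
and `M`, `N` `R`-modules. The `R`-linear map `(M ⊗_R N)^∧_I → (M^∧_I ⊗_R N^∧_I)^∧_I`
obtained by applying `I`-adic completion to `γ_M ⊗ γ_N : M ⊗_R N → M^∧_I ⊗_R N^∧_I` is an
isomorphism. -/
theorem adicCompletion_tensor_completion_both {R : Type*} [CommRing R] (I : Ideal R)
    (hI : I.FG) (M N : Type*) [AddCommGroup M] [Module R M] [AddCommGroup N] [Module R N] :
    Function.Bijective
      (AdicCompletion.map I
        (TensorProduct.map (AdicCompletion.of I M) (AdicCompletion.of I N))) :=
  ⟨AdicCompletion.map_injective_of_comap_pow_smul_top_le I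
      (AdicCompletion.comap_map_of_pow_smul_top_le I),
    AdicCompletion.map_surjective_of_mkQ_comp_surjective
      (AdicCompletion.mkQ_comp_map_of_surjective I hI)⟩
end

section
/- Let R be a commutative ring, I a finitely generated ideal of R, and M an R-module. Then Tor_n^R(R/I, M) = 0 for all n ≥ 0 if and only if Ext_R^n(R/I, M) = 0 for all n ≥ 0. -/
open CategoryTheory CategoryTheory.Limits

universe u v

/-- A cochain complex of `R`-modules indexed by `ℤ`, with unbundled terms. -/
structure LinearComplex (R : Type u) [CommRing R] where
  /-- The terms of the complex. -/
  X : ℤ → Type v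
  [addCommGroup : ∀ n, AddCommGroup (X n)]
  [module : ∀ n, Module R (X n)]
  /-- The differential. -/
  d : ∀ n, X n →ₗ[R] X (n + 1)
  d_d : ∀ n c, d (n + 1) (d n c) = 0

namespace LinearComplex

attribute [instance] addCommGroup module
attribute [simp] d_d

variable {R : Type u} [CommRing R]

/-- Every cocycle is a coboundary. -/
def Acyclic (C : LinearComplex.{u, v} R) : Prop :=
  ∀ n (c : C.X (n + 1)), C.d (n + 1) c = 0 → ∃ b, C.d n b = c

/-- The complex `C / I C` is acyclic. -/
def AcyclicMod (I : Ideal R) (C : LinearComplex.{u, v} R) : Prop :=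
  ∀ n (c : C.X (n + 1)), C.d (n + 1) c ∈ I • (⊤ : Submodule R (C.X (n + 1 + 1))) →
    ∃ b, c - C.d n b ∈ I • (⊤ : Submodule R (C.X (n + 1)))

/-- The subcomplex of elements of `C` annihilated by `I` is acyclic. -/
def AcyclicTorsion (I : Ideal R) (C : LinearComplex.{u, v} R) : Prop :=
  ∀ n (c : C.X (n + 1)), (∀ x ∈ I, x • c = 0) → C.d (n + 1) c = 0 →
    ∃ b, (∀ x ∈ I, x • b = 0) ∧ C.d n b = c

/-- Multiplication by `y` on `C` is homotopic to zero. -/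
def NullHomotopic (y : R) (C : LinearComplex.{u, v} R) : Prop :=
  ∃ h : ∀ n, C.X (n + 1) →ₗ[R] C.X n, ∀ n (c : C.X (n + 1)),
    C.d n (h n c) + h (n + 1) (C.d (n + 1) c) = y • c

/-- Multiplication by any element of `I` is zero on the cohomology of `C`. -/
def KillsCohomology (I : Ideal R) (C : LinearComplex.{u, v} R) : Prop :=
  ∀ y ∈ I, ∀ n (c : C.X (n + 1)), C.d (n + 1) c = 0 → ∃ b, C.d n b = y • c

/-- A bounded above complex of projective modules. -/
def IsBoundedProjective (C : LinearComplex.{u, v} R) : Prop :=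
  (∀ n, Module.Projective R (C.X n)) ∧ ∃ N : ℤ, ∀ n, N ≤ n → Subsingleton (C.X n)

/-- A bounded below complex of injective modules. -/
def IsBoundedInjective (C : LinearComplex.{u, v} R) : Prop :=
  (∀ n, Module.Injective R (C.X n)) ∧ ∃ N : ℤ, ∀ n, n ≤ N → Subsingleton (C.X n)

lemma int_induction_down {P : ℤ → Prop} {N : ℤ} (base : ∀ n, N ≤ n → P n)
    (step : ∀ n, P (n + 1) → P n) (n : ℤ) : P n := by
  have key : ∀ k : ℕ, ∀ n, N - k ≤ n → P n := by
    intro k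
    induction k with
    | zero => intro n hn; exact base n (by simpa using hn)
    | succ k ih => intro n hn; exact step n (ih _ (by push_cast at hn; linarith))
  exact key (N - n).toNat n (by omega)

lemma int_induction_up {P : ℤ → Prop} {N : ℤ} (base : ∀ n, n ≤ N → P n)
    (step : ∀ n, P n → P (n + 1)) (n : ℤ) : P n := by
  refine neg_neg n ▸ int_induction_down (P := fun n ↦ P (-n)) (N := -N)
    (fun n hn ↦ base _ (by linarith)) (fun n hn ↦ ?_) (-n)
  have := step _ hn
  rwa [neg_add, neg_add_cancel_right] at this

section Projective

/-- The cocycles in degree `n` form a direct summand. -/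
def CocyclesRetract (C : LinearComplex.{u, v} R) (n : ℤ) : Prop :=
  ∃ π : C.X n →ₗ[R] C.X n, (∀ w, C.d n (π w) = 0) ∧ ∀ z, C.d n z = 0 → π z = z

variable {C : LinearComplex.{u, v} R} {I : Ideal R}

lemma CocyclesRetract.pred (hC : ∀ n, Module.Projective R (C.X n)) {n : ℤ}
    (h : C.CocyclesRetract (n + 1))
    (hex : ∀ c : C.X (n + 1), C.d (n + 1) c = 0 → ∃ b, C.d n b = c) :
    C.CocyclesRetract n := by
  obtain ⟨π, hπ, hπ'⟩ := h
  have := hC (n + 1)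
  let g : C.X n →ₗ[R] LinearMap.ker (C.d (n + 1)) := (C.d n).codRestrict _ (by simp)
  let p : C.X (n + 1) →ₗ[R] LinearMap.ker (C.d (n + 1)) := π.codRestrict _ hπ
  have hg : Function.Surjective g := by
    rintro ⟨c, hc⟩
    obtain ⟨b, hb⟩ := hex c hc
    exact ⟨b, Subtype.ext hb⟩
  obtain ⟨σ, hσ⟩ := Module.projective_lifting_property g p hg
  have hσ' : ∀ c, C.d n (σ c) = π c := fun c ↦ congrArg Subtype.val (LinearMap.congr_fun hσ c)
  refine ⟨LinearMap.id - σ ∘ₗ C.d n, fun w ↦ ?_, fun z hz ↦ by simp [hz]⟩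
  simp [hσ', hπ' (C.d n w)]

lemma cocyclesRetract_of_subsingleton {n : ℤ} (h : Subsingleton (C.X n)) :
    C.CocyclesRetract n :=
  ⟨0, by simp, fun _ _ ↦ Subsingleton.elim _ _⟩

lemma AcyclicMod.acyclic (h : C.AcyclicMod I) (hC : C.IsBoundedProjective)
    (hI : C.KillsCohomology I) : C.Acyclic := by
  have hex : ∀ n, C.CocyclesRetract (n + 1) →
      ∀ c : C.X (n + 1), C.d (n + 1) c = 0 → ∃ b, C.d n b = c := by
    rintro n ⟨π, hπ, hπ'⟩ c hc
    obtain ⟨b, hb⟩ := h n c (by simp [hc])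
    have key : I • (⊤ : Submodule R (C.X (n + 1))) ≤ (LinearMap.range (C.d n)).comap π := by
      rw [Submodule.smul_le]
      intro x hx w _
      simpa using hI x hx n (π w) (hπ w)
    obtain ⟨b', hb'⟩ := key hb
    rw [hπ' _ (by simp [hc])] at hb'
    exact ⟨b' + b, by simp [hb']⟩
  obtain ⟨N, hN⟩ := hC.2
  have := int_induction_down (fun n hn ↦ cocyclesRetract_of_subsingleton (hN n hn))
    (fun n hn ↦ hn.pred hC.1 (hex n hn))
  exact fun n ↦ hex n (this _)

lemma Acyclic.acyclicMod (h : C.Acyclic) (hC : C.IsBoundedProjective) (I : Ideal R) :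
    C.AcyclicMod I := by
  obtain ⟨N, hN⟩ := hC.2
  have hret := int_induction_down (fun n hn ↦ cocyclesRetract_of_subsingleton (hN n hn))
    (fun n hn ↦ hn.pred hC.1 (h n))
  intro n c hc
  obtain ⟨π, hπ, hπ'⟩ := hret (n + 1 + 1)
  have key : I • (⊤ : Submodule R (C.X (n + 1 + 1))) ≤
      ((I • (⊤ : Submodule R (C.X (n + 1)))).map (C.d (n + 1))).comap π := by
    rw [Submodule.smul_le]
    intro x hx w _
    obtain ⟨b, hb⟩ := h _ (π w) (hπ w)
    exact ⟨x • b, Submodule.smul_mem_smul hx trivial, by simp [hb]⟩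
  obtain ⟨b, hb, hbc⟩ := key hc
  rw [hπ' _ (by simp)] at hbc
  obtain ⟨a, ha⟩ := h n (c - b) (by simp [hbc])
  exact ⟨a, by simpa [ha] using hb⟩

end Projective

section Injective

/-- The coboundaries in degree `n + 1` form a direct summand. -/
def CoboundariesRetract (C : LinearComplex.{u, v} R) (n : ℤ) : Prop :=
  ∃ ρ : C.X (n + 1) →ₗ[R] C.X (n + 1),
    (∀ w, ∃ b, C.d n b = ρ w) ∧ ∀ b, ρ (C.d n b) = C.d n b

variable {C : LinearComplex.{u, v} R} {I : Ideal R}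

lemma CoboundariesRetract.succ (hC : ∀ n, Module.Injective R (C.X n)) {n : ℤ}
    (h : C.CoboundariesRetract n)
    (hex : ∀ c : C.X (n + 1), C.d (n + 1) c = 0 → ∃ b, C.d n b = c) :
    C.CoboundariesRetract (n + 1) := by
  obtain ⟨ρ, hρ, hρ'⟩ := h
  have := hC (n + 1)
  let i := (LinearMap.ker (C.d (n + 1))).liftQ (C.d (n + 1)) le_rfl
  let g := (LinearMap.ker (C.d (n + 1))).liftQ (LinearMap.id - ρ) (by
    intro c hc
    obtain ⟨b, rfl⟩ := hex c hc
    simp [hρ'])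
  have hi : Function.Injective i := LinearMap.ker_eq_bot.mp (Submodule.ker_liftQ_eq_bot' _ _ rfl)
  obtain ⟨τ, hτ⟩ := Module.Injective.out i hi g
  have hτ' : ∀ c, τ (C.d (n + 1) c) = c - ρ c := fun c ↦ hτ (Submodule.Quotient.mk c)
  refine ⟨C.d (n + 1) ∘ₗ τ, fun w ↦ ⟨τ w, rfl⟩, fun c ↦ ?_⟩
  obtain ⟨b, hb⟩ := hρ c
  simp [hτ', ← hb]

lemma coboundariesRetract_of_subsingleton {n : ℤ} (h : Subsingleton (C.X n)) :
    C.CoboundariesRetract n :=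
  ⟨0, fun _ ↦ ⟨0, by simp⟩, fun b ↦ by simp [Subsingleton.elim b 0]⟩

lemma AcyclicTorsion.acyclic (h : C.AcyclicTorsion I) (hC : C.IsBoundedInjective)
    (hI : C.KillsCohomology I) : C.Acyclic := by
  have hex : ∀ n, C.CoboundariesRetract n →
      ∀ c : C.X (n + 1), C.d (n + 1) c = 0 → ∃ b, C.d n b = c := by
    rintro n ⟨ρ, hρ, hρ'⟩ c hc
    obtain ⟨b, hb⟩ := hρ c
    obtain ⟨b', -, hb'⟩ := h n (c - ρ c) (fun x hx ↦ by
      obtain ⟨a, ha⟩ := hI x hx n c hc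
      rw [smul_sub, ← map_smul, ← ha, hρ', sub_self]) (by simp [hc, ← hb])
    exact ⟨b' + b, by simp [hb', hb]⟩
  obtain ⟨N, hN⟩ := hC.2
  have := int_induction_up (fun n hn ↦ coboundariesRetract_of_subsingleton (hN n hn))
    (fun n hn ↦ hn.succ hC.1 (hex n hn))
  exact fun n ↦ hex n (this _)

lemma Acyclic.acyclicTorsion (h : C.Acyclic) (hC : C.IsBoundedInjective) (I : Ideal R) :
    C.AcyclicTorsion I := by
  obtain ⟨N, hN⟩ := hC.2
  have hret := int_induction_up (fun n hn ↦ coboundariesRetract_of_subsingleton (hN n hn))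
    (fun n hn ↦ hn.succ hC.1 (h n))
  intro n c hcI hc
  obtain ⟨n, rfl⟩ : ∃ m, n = m + 1 := ⟨n - 1, by simp⟩
  obtain ⟨ρ, hρ, hρ'⟩ := hret n
  obtain ⟨b, rfl⟩ := h _ c hc
  obtain ⟨a, ha⟩ := hρ b
  refine ⟨b - ρ b, fun x hx ↦ ?_, by simp [← ha]⟩
  obtain ⟨e, he⟩ := h n (x • (b - ρ b)) (by simp [← ha, hcI x hx])
  rw [← he, ← hρ', he, map_smul, map_sub, ← ha, hρ', sub_self, smul_zero]

end Injective

section Cone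

/-- The mapping cone (up to a shift) of multiplication by `x` on `C`. -/
def cone (x : R) (C : LinearComplex.{u, v} R) : LinearComplex.{u, v} R where
  X n := C.X n × C.X (n + 1)
  d n := (C.d n ∘ₗ LinearMap.fst R _ _ + x • LinearMap.snd R _ _).prod
    (-(C.d (n + 1) ∘ₗ LinearMap.snd R _ _))
  d_d n c := by simp

variable {C D : LinearComplex.{u, v} R} {I : Ideal R} {x y : R} {n : ℤ}

/-- The element of the cone with given components. -/
def coneMk (x : R) (a : C.X n) (b : C.X (n + 1)) : (cone x C).X n := (a, b)

lemma coneMk_surjective (c : (cone x C).X n) : ∃ a b, c = coneMk x a b := ⟨c.1, c.2, rfl⟩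

@[simp]
lemma coneMk_inj {a a' : C.X n} {b b' : C.X (n + 1)} :
    coneMk x a b = coneMk x a' b' ↔ a = a' ∧ b = b' := Prod.mk_inj

@[simp]
lemma coneMk_eq_zero_iff {a : C.X n} {b : C.X (n + 1)} :
    coneMk x a b = 0 ↔ a = 0 ∧ b = 0 := Prod.mk_inj

@[simp]
lemma coneMk_add (a a' : C.X n) (b b' : C.X (n + 1)) :
    coneMk x a b + coneMk x a' b' = coneMk x (a + a') (b + b') := rfl

@[simp]
lemma coneMk_sub (a a' : C.X n) (b b' : C.X (n + 1)) :
    coneMk x a b - coneMk x a' b' = coneMk x (a - a') (b - b') := rfl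

@[simp]
lemma smul_coneMk (a : C.X n) (b : C.X (n + 1)) :
    y • coneMk x a b = coneMk x (y • a) (y • b) := rfl

@[simp]
lemma cone_d_coneMk (a : C.X n) (b : C.X (n + 1)) :
    (cone x C).d n (coneMk x a b) = coneMk x (C.d n a + x • b) (-C.d (n + 1) b) := rfl

@[simp]
lemma coneMk_mem_smul_top {a : C.X n} {b : C.X (n + 1)} :
    coneMk x a b ∈ I • (⊤ : Submodule R ((cone x C).X n)) ↔
      a ∈ I • (⊤ : Submodule R (C.X n)) ∧ b ∈ I • (⊤ : Submodule R (C.X (n + 1))) := by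
  let fst : (cone x C).X n →ₗ[R] C.X n := LinearMap.fst R _ _
  let snd : (cone x C).X n →ₗ[R] C.X (n + 1) := LinearMap.snd R _ _
  let inl : C.X n →ₗ[R] (cone x C).X n := LinearMap.inl R _ _
  let inr : C.X (n + 1) →ₗ[R] (cone x C).X n := LinearMap.inr R _ _
  refine ⟨fun h ↦ ⟨Submodule.smul_top_le_comap_smul_top I fst h,
    Submodule.smul_top_le_comap_smul_top I snd h⟩, fun ⟨ha, hb⟩ ↦ ?_⟩
  have : coneMk x a b = inl a + inr b := Prod.ext (add_zero a).symm (zero_add b).symm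
  rw [this]
  exact add_mem (Submodule.smul_top_le_comap_smul_top I inl ha)
    (Submodule.smul_top_le_comap_smul_top I inr hb)

lemma NullHomotopic.cone (h : C.NullHomotopic y) (x : R) : (C.cone x).NullHomotopic y := by
  obtain ⟨h, hh⟩ := h
  refine ⟨fun n ↦ (h n).prodMap (-h (n + 1)), fun n c ↦ ?_⟩
  obtain ⟨a, b, rfl⟩ := coneMk_surjective c
  change (C.cone x).d n (coneMk x (h n a) (-h (n + 1) b)) +
    coneMk x (h (n + 1) (C.d (n + 1) a + x • b)) (-h (n + 1 + 1) (-C.d (n + 1 + 1) b)) = _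
  simp only [cone_d_coneMk, coneMk_add, smul_coneMk, coneMk_inj, ← hh, map_add, map_neg, map_smul,
    neg_neg, and_true]
  module

lemma nullHomotopic_cone (x : R) (C : LinearComplex.{u, v} R) : (C.cone x).NullHomotopic x := by
  refine ⟨fun n ↦ (0 : _ →ₗ[R] C.X n).prod (LinearMap.fst R _ _), fun n c ↦ ?_⟩
  obtain ⟨a, b, rfl⟩ := coneMk_surjective c
  change (C.cone x).d n (coneMk x 0 a) + coneMk x 0 (C.d (n + 1) a + x • b) = _
  simp

lemma IsBoundedProjective.cone (h : C.IsBoundedProjective) (x : R) :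
    (C.cone x).IsBoundedProjective := by
  obtain ⟨h, N, hN⟩ := h
  refine ⟨fun n ↦ ?_, N, fun n hn ↦ ?_⟩
  · have := h n
    have := h (n + 1)
    exact inferInstanceAs (Module.Projective R (C.X n × C.X (n + 1)))
  · have := hN n hn
    have := hN (n + 1) (by linarith)
    exact inferInstanceAs (Subsingleton (C.X n × C.X (n + 1)))

lemma IsBoundedInjective.cone (h : C.IsBoundedInjective) (x : R) :
    (C.cone x).IsBoundedInjective := by
  obtain ⟨h, N, hN⟩ := h
  refine ⟨fun n ↦ ⟨fun Y Z _ _ _ _ f hf g ↦ ?_⟩, N - 1, fun n hn ↦ ?_⟩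
  · obtain ⟨g₁, h₁⟩ := (h n).out f hf (LinearMap.fst R _ _ ∘ₗ g)
    obtain ⟨g₂, h₂⟩ := (h (n + 1)).out f hf (LinearMap.snd R _ _ ∘ₗ g)
    exact ⟨g₁.prod g₂, fun y ↦ Prod.ext (h₁ y) (h₂ y)⟩
  · have := hN n (by linarith)
    have := hN (n + 1) (by linarith)
    exact inferInstanceAs (Subsingleton (C.X n × C.X (n + 1)))

lemma acyclicMod_cone_iff (hx : x ∈ I) : (C.cone x).AcyclicMod I ↔ C.AcyclicMod I := by
  have hxI {n : ℤ} (c : C.X n) : x • c ∈ I • (⊤ : Submodule R (C.X n)) :=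
    Submodule.smul_mem_smul hx trivial
  refine ⟨fun h n c hc ↦ ?_, fun h n c hc ↦ ?_⟩
  · obtain ⟨n, rfl⟩ : ∃ m, n = m + 1 := ⟨n - 1, by simp⟩
    obtain ⟨e, he⟩ := h n (coneMk x 0 c) (by simp [hxI, hc])
    obtain ⟨a, b, rfl⟩ := coneMk_surjective e
    rw [cone_d_coneMk, coneMk_sub, coneMk_mem_smul_top] at he
    exact ⟨-b, by simpa using he.2⟩
  · obtain ⟨a, b, rfl⟩ := coneMk_surjective c
    simp only [cone_d_coneMk, coneMk_mem_smul_top, Submodule.add_mem_iff_left _ (hxI b),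
      neg_mem_iff] at hc
    obtain ⟨u, hu⟩ := h n a hc.1
    obtain ⟨v, hv⟩ := h (n + 1) b hc.2
    refine ⟨coneMk x u (-v), ?_⟩
    rw [cone_d_coneMk, coneMk_sub, coneMk_mem_smul_top]
    refine ⟨?_, by simpa using hv⟩
    convert add_mem hu (hxI v) using 1
    module

lemma acyclicTorsion_cone_iff (hx : x ∈ I) :
    (C.cone x).AcyclicTorsion I ↔ C.AcyclicTorsion I := by
  refine ⟨fun h n c hcI hc ↦ ?_, fun h n c hcI hc ↦ ?_⟩
  · obtain ⟨n, rfl⟩ : ∃ m, n = m + 1 := ⟨n - 1, by simp⟩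
    obtain ⟨e, heI, he⟩ := h n (coneMk x 0 c) (fun y hy ↦ by simp [hcI y hy])
      (by simp [hcI x hx, hc])
    obtain ⟨a, b, rfl⟩ := coneMk_surjective e
    simp only [smul_coneMk, coneMk_eq_zero_iff, cone_d_coneMk, coneMk_inj] at heI he
    exact ⟨-b, fun y hy ↦ by simp [heI y hy], by simp [he.2]⟩
  · obtain ⟨a, b, rfl⟩ := coneMk_surjective c
    simp only [smul_coneMk, coneMk_eq_zero_iff, cone_d_coneMk, neg_eq_zero] at hcI hc
    obtain ⟨u, hu, hua⟩ := h n a (fun y hy ↦ (hcI y hy).1) (by simpa [hcI x hx] using hc.1)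
    obtain ⟨v, hv, hvb⟩ := h (n + 1) b (fun y hy ↦ (hcI y hy).2) hc.2
    exact ⟨coneMk x u (-v), fun y hy ↦ by simp [hu y hy, hv y hy], by simp [hv x hx, hua, hvb]⟩

/-- There is a quasi-isomorphism from `C` to `D`. -/
def HasQuasiIso (C D : LinearComplex.{u, v} R) : Prop :=
  ∃ f : ∀ n, C.X n →ₗ[R] D.X n, (∀ n c, f (n + 1) (C.d n c) = D.d n (f n c)) ∧
    (∀ n (c : C.X (n + 1)), C.d (n + 1) c = 0 → (∃ e, D.d n e = f (n + 1) c) →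
      ∃ b, C.d n b = c) ∧
    ∀ n (e : D.X (n + 1)), D.d (n + 1) e = 0 →
      ∃ c, C.d (n + 1) c = 0 ∧ ∃ b, D.d n b = e - f (n + 1) c

lemma HasQuasiIso.acyclic_iff (h : HasQuasiIso C D) : C.Acyclic ↔ D.Acyclic := by
  obtain ⟨f, hf, hinj, hsurj⟩ := h
  refine ⟨fun h n e he ↦ ?_, fun h n c hc ↦ ?_⟩
  · obtain ⟨c, hc, b, hb⟩ := hsurj n e he
    obtain ⟨a, rfl⟩ := h n c hc
    exact ⟨b + f n a, by simp [hb, hf]⟩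
  · exact hinj n c hc (h n _ (by rw [← hf, hc, map_zero]))

lemma HasQuasiIso.cone (h : HasQuasiIso C D) (x : R) : HasQuasiIso (C.cone x) (D.cone x) := by
  obtain ⟨f, hf, hinj, hsurj⟩ := h
  let F n : (C.cone x).X n →ₗ[R] (D.cone x).X n := (f n).prodMap (f (n + 1))
  have hF n (a : C.X n) (b : C.X (n + 1)) :
    F n (coneMk x a b) = coneMk x (f n a) (f (n + 1) b) := rfl
  refine ⟨F, fun n c ↦ ?_, fun n c hc ⟨e, he⟩ ↦ ?_, fun n e he ↦ ?_⟩
  · obtain ⟨a, b, rfl⟩ := coneMk_surjective c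
    simp [hF, hf]
  · obtain ⟨a, b, rfl⟩ := coneMk_surjective c
    obtain ⟨u, v, rfl⟩ := coneMk_surjective e
    simp only [hF, cone_d_coneMk, coneMk_inj, coneMk_eq_zero_iff, neg_eq_zero] at hc he
    obtain ⟨β, rfl⟩ := hinj (n + 1) b hc.2 ⟨-v, by simpa using he.2⟩
    obtain ⟨c, hc', w, hw⟩ := hsurj n (f (n + 1) β + v) (by
      rw [map_add, ← hf, ← he.2, neg_add_cancel])
    obtain ⟨α, hα⟩ := hinj n (a + x • β - x • c)
      (by simpa [hc'] using hc.1)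
      ⟨u + x • w, by simp only [map_add, map_sub, map_smul, ← he.1, hw]; module⟩
    refine ⟨coneMk x α (c - β), ?_⟩
    simp only [cone_d_coneMk, coneMk_inj, hα, map_sub, hc', zero_sub, neg_neg, and_true]
    module
  · obtain ⟨u, v, rfl⟩ := coneMk_surjective e
    simp only [cone_d_coneMk, coneMk_eq_zero_iff, neg_eq_zero] at he
    have hu := eq_neg_of_add_eq_zero_left he.1
    obtain ⟨b, hb, e, he'⟩ := hsurj (n + 1) v he.2
    obtain ⟨a, ha⟩ := hinj (n + 1) (x • b) (by simp [hb]) ⟨-u - x • e, by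
      simp only [map_sub, map_neg, map_smul, he', hu]; module⟩
    obtain ⟨c, hc, w, hw⟩ := hsurj n (u + f (n + 1) a + x • e) (by
      simp only [map_add, map_smul, he', ← hf, ha, hu]; module)
    refine ⟨coneMk x (c - a) b, by simp [hc, ha, hb], coneMk x w (-e), ?_⟩
    simp only [hF, cone_d_coneMk, coneMk_sub, coneMk_inj, map_sub, map_neg, hw, he', neg_neg,
      and_true]
    module

end Cone

section Koszul

/-- The Koszul complex of a list of elements of `R` with coefficients in `C`. -/
def koszul (l : List R) (C : LinearComplex.{u, v} R) : LinearComplex.{u, v} R :=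
  l.foldl (fun C x ↦ C.cone x) C

variable {C D : LinearComplex.{u, v} R} {I : Ideal R} {l : List R}

/-- A property stable under cones is stable under Koszul complexes. -/
lemma koszul_induction {P : LinearComplex.{u, v} R → Prop} (hP : ∀ C, P C → ∀ x, P (C.cone x))
    (l : List R) : ∀ {C}, P C → P (koszul l C) := by
  induction l with
  | nil => exact id
  | cons x l ih => exact fun h ↦ ih (hP _ h x)

lemma nullHomotopic_koszul {y : R} (hy : y ∈ l) (C : LinearComplex.{u, v} R) :
    (koszul l C).NullHomotopic y := by
  induction l generalizing C with
  | nil => simp at hy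
  | cons x l ih =>
    rcases List.mem_cons.1 hy with rfl | hy
    · exact koszul_induction (fun _ h ↦ h.cone) l (nullHomotopic_cone y C)
    · exact ih hy _

lemma killsCohomology_koszul (l : List R) (C : LinearComplex.{u, v} R) :
    (koszul l C).KillsCohomology (Ideal.span {x | x ∈ l}) := by
  intro y hy n c hc
  suffices Ideal.span {x | x ∈ l} ≤ (LinearMap.range ((koszul l C).d n)).comap
      (LinearMap.toSpanSingleton R _ c) by simpa using this hy
  rw [Ideal.span_le]
  intro x hx
  obtain ⟨h, hh⟩ := nullHomotopic_koszul hx C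
  exact ⟨h n c, by simpa [hc] using hh n c⟩

lemma acyclicMod_koszul_iff (hl : ∀ x ∈ l, x ∈ I) :
    (koszul l C).AcyclicMod I ↔ C.AcyclicMod I := by
  induction l generalizing C with
  | nil => rfl
  | cons x l ih =>
    simp only [List.mem_cons, forall_eq_or_imp] at hl
    exact (ih hl.2).trans (acyclicMod_cone_iff hl.1)

lemma acyclicTorsion_koszul_iff (hl : ∀ x ∈ l, x ∈ I) :
    (koszul l C).AcyclicTorsion I ↔ C.AcyclicTorsion I := by
  induction l generalizing C with
  | nil => rfl
  | cons x l ih =>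
    simp only [List.mem_cons, forall_eq_or_imp] at hl
    exact (ih hl.2).trans (acyclicTorsion_cone_iff hl.1)

lemma HasQuasiIso.koszul (h : HasQuasiIso C D) (l : List R) :
    HasQuasiIso (koszul l C) (koszul l D) := by
  induction l generalizing C D with
  | nil => exact h
  | cons x l ih => exact ih (h.cone x)

lemma IsBoundedProjective.acyclicMod_iff (h : C.IsBoundedProjective) (l : List R) :
    C.AcyclicMod (Ideal.span {x | x ∈ l}) ↔ (koszul l C).Acyclic := by
  have h' : (koszul l C).IsBoundedProjective := koszul_induction (fun _ h ↦ h.cone) l h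
  rw [← acyclicMod_koszul_iff (I := Ideal.span {x | x ∈ l}) (l := l)
    fun x hx ↦ Ideal.subset_span hx]
  exact ⟨fun H ↦ H.acyclic h' (killsCohomology_koszul l C), fun H ↦ H.acyclicMod h' _⟩

lemma IsBoundedInjective.acyclicTorsion_iff (h : C.IsBoundedInjective) (l : List R) :
    C.AcyclicTorsion (Ideal.span {x | x ∈ l}) ↔ (koszul l C).Acyclic := by
  have h' : (koszul l C).IsBoundedInjective := koszul_induction (fun _ h ↦ h.cone) l h
  rw [← acyclicTorsion_koszul_iff (I := Ideal.span {x | x ∈ l}) (l := l)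
    fun x hx ↦ Ideal.subset_span hx]
  exact ⟨fun H ↦ H.acyclic h' (killsCohomology_koszul l C), fun H ↦ H.acyclicTorsion h' _⟩

/-- For quasi-isomorphic complexes of projectives and injectives, reduction modulo a finitely
generated ideal `I` is acyclic if and only if `I`-torsion is. -/
theorem HasQuasiIso.acyclicMod_iff_acyclicTorsion (h : HasQuasiIso C D)
    (hC : C.IsBoundedProjective) (hD : D.IsBoundedInjective) (hI : I.FG) :
    C.AcyclicMod I ↔ D.AcyclicTorsion I := by
  obtain ⟨s, rfl⟩ := hI
  have : (s : Set R) = {x | x ∈ s.toList} := by ext; simp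
  rw [this, hC.acyclicMod_iff, hD.acyclicTorsion_iff, (h.koszul _).acyclic_iff]

end Koszul

end LinearComplex

open scoped TensorProduct

section

variable {R : Type u} [CommRing R]

/-- The terms of a chain complex, placed in nonpositive cohomological degrees. -/
noncomputable def chainObj (K : ChainComplex (ModuleCat.{v} R) ℕ) : ℤ → ModuleCat.{v} R
  | Int.ofNat 0 => K.X 0
  | Int.ofNat (_ + 1) => ModuleCat.of R PUnit
  | Int.negSucc k => K.X (k + 1)

/-- The differentials of a chain complex, placed in nonpositive cohomological degrees. -/
noncomputable def chainMap (K : ChainComplex (ModuleCat.{v} R) ℕ) :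
    ∀ n : ℤ, chainObj K n →ₗ[R] chainObj K (n + 1)
  | Int.ofNat _ => 0
  | Int.negSucc 0 => (K.d 1 0).hom
  | Int.negSucc (k + 1) => (K.d (k + 2) (k + 1)).hom

/-- The terms of a cochain complex indexed by `ℕ`, extended by zero to negative degrees. -/
noncomputable def cochainObj (K : CochainComplex (ModuleCat.{v} R) ℕ) : ℤ → ModuleCat.{v} R
  | Int.ofNat k => K.X k
  | Int.negSucc _ => ModuleCat.of R PUnit

/-- The differentials of a cochain complex indexed by `ℕ`, extended by zero to negative
degrees. -/
noncomputable def cochainMap (K : CochainComplex (ModuleCat.{v} R) ℕ) :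
    ∀ n : ℤ, cochainObj K n →ₗ[R] cochainObj K (n + 1)
  | Int.ofNat k => (K.d k (k + 1)).hom
  | Int.negSucc _ => 0

lemma moduleCat_d_d {ι : Type*} {c : ComplexShape ι}
    (K : HomologicalComplex (ModuleCat.{v} R) c) (i j k : ι) (x : K.X i) :
    (K.d j k).hom ((K.d i j).hom x) = 0 := by
  have := K.d_comp_d i j k
  exact congr($(this).hom x)

/-- A chain complex indexed by `ℕ` as a complex indexed by `ℤ`. -/
noncomputable def LinearComplex.ofChain (K : ChainComplex (ModuleCat.{v} R) ℕ) :
    LinearComplex.{u, v} R where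
  X n := chainObj K n
  d := chainMap K
  d_d
    | Int.ofNat _, _ => rfl
    | Int.negSucc 0, _ => rfl
    | Int.negSucc 1, c => moduleCat_d_d K 2 1 0 c
    | Int.negSucc (k + 2), c => moduleCat_d_d K (k + 3) (k + 2) (k + 1) c

/-- A cochain complex indexed by `ℕ` as a complex indexed by `ℤ`. -/
noncomputable def LinearComplex.ofCochain (K : CochainComplex (ModuleCat.{v} R) ℕ) :
    LinearComplex.{u, v} R where
  X n := cochainObj K n
  d := cochainMap K
  d_d
    | Int.ofNat n, c => moduleCat_d_d K n (n + 1) (n + 2) c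
    | Int.negSucc _, _ => map_zero _

variable {M : ModuleCat.{u} R} (P : ProjectiveResolution M) (J : InjectiveResolution M)

lemma isBoundedProjective_ofChain :
    (LinearComplex.ofChain P.complex).IsBoundedProjective := by
  constructor
  · rintro ((_ | k) | k)
    · exact (IsProjective.iff_projective (P.complex.X 0)).2 (P.projective 0)
    · exact inferInstanceAs (Module.Projective R PUnit.{u + 1})
    · exact (IsProjective.iff_projective (P.complex.X (k + 1))).2 (P.projective (k + 1))
  · refine ⟨1, ?_⟩
    rintro ((_ | k) | k) h
    · simp at h
    · exact inferInstanceAs (Subsingleton PUnit.{u + 1})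
    · exact absurd h (by omega)

lemma isBoundedInjective_ofCochain :
    (LinearComplex.ofCochain J.cocomplex).IsBoundedInjective := by
  constructor
  · rintro (k | k)
    · exact (Module.injective_iff_injective_object R (J.cocomplex.X k)).2 (J.injective k)
    · exact ⟨fun X Y _ _ _ _ f hf g ↦ ⟨0, fun x ↦ rfl⟩⟩
  · refine ⟨-1, ?_⟩
    rintro (k | k) h
    · exact absurd h (by simp; omega)
    · exact inferInstanceAs (Subsingleton PUnit.{u + 1})

lemma projectiveResolution_exact_zero (x : P.complex.X 0) (hx : (P.π.f 0).hom x = 0) :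
    ∃ y, (P.complex.d 1 0).hom y = x :=
  (ShortComplex.moduleCat_exact_iff _).1 P.exact₀ x hx

lemma projectiveResolution_exact_succ (n : ℕ) (x : P.complex.X (n + 1))
    (hx : (P.complex.d (n + 1) n).hom x = 0) :
    ∃ y, (P.complex.d (n + 2) (n + 1)).hom y = x :=
  (ShortComplex.moduleCat_exact_iff _).1 (P.exact_succ n) x hx

lemma injectiveResolution_exact_zero (x : J.cocomplex.X 0)
    (hx : (J.cocomplex.d 0 1).hom x = 0) : ∃ y, (J.ι.f 0).hom y = x :=
  (ShortComplex.moduleCat_exact_iff _).1 J.exact₀ x hx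

lemma injectiveResolution_exact_succ (n : ℕ) (x : J.cocomplex.X (n + 1))
    (hx : (J.cocomplex.d (n + 1) (n + 2)).hom x = 0) :
    ∃ y, (J.cocomplex.d n (n + 1)).hom y = x :=
  (ShortComplex.moduleCat_exact_iff _).1 (J.exact_succ n) x hx

/-- The augmentation of a projective resolution followed by the coaugmentation of an injective
resolution. -/
noncomputable def augmentation : P.complex.X 0 ⟶ J.cocomplex.X 0 :=
  (P.π.f 0 : P.complex.X 0 ⟶ M) ≫ (J.ι.f 0 : M ⟶ J.cocomplex.X 0)

lemma hasQuasiIso_ofChain_ofCochain :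
    (LinearComplex.ofChain P.complex).HasQuasiIso (LinearComplex.ofCochain J.cocomplex) := by
  have hπ : ∀ x, (P.π.f 0).hom ((P.complex.d 1 0).hom x) = 0 := fun x ↦
    congr($(P.complex_d_comp_π_f_zero).hom x)
  have hι : ∀ x, (J.cocomplex.d 0 1).hom ((J.ι.f 0).hom x) = 0 := fun x ↦
    congr($(J.ι_f_zero_comp_complex_d).hom x)
  have hπs : Function.Surjective (P.π.f 0).hom := (ModuleCat.epi_iff_surjective _).1 inferInstance
  have hιi : Function.Injective (J.ι.f 0).hom := (ModuleCat.mono_iff_injective _).1 inferInstance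
  refine ⟨fun n ↦ match n with
    | Int.ofNat 0 => (augmentation P J).hom
    | Int.ofNat (_ + 1) => 0
    | Int.negSucc _ => 0, ?_, ?_, ?_⟩
  · rintro ((_ | k) | (_ | k)) c
    · exact (hι _).symm
    · exact (map_zero _).symm
    · exact (congrArg (J.ι.f 0).hom (hπ c)).trans (map_zero _)
    · rfl
  · rintro ((_ | k) | (_ | _ | k)) c hc ⟨e, he⟩
    · exact ⟨0, rfl⟩
    · exact ⟨0, rfl⟩
    · refine projectiveResolution_exact_zero P c (hιi (he.symm.trans (map_zero _).symm))
    · exact projectiveResolution_exact_succ P 0 c hc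
    · exact projectiveResolution_exact_succ P (k + 1) c hc
  · rintro (k | (_ | k)) e he
    · obtain ⟨b, hb⟩ := injectiveResolution_exact_succ J k e he
      exact ⟨0, rfl, b, hb.trans (sub_zero e).symm⟩
    · obtain ⟨y, hy⟩ := injectiveResolution_exact_zero J e he
      obtain ⟨c, rfl⟩ := hπs y
      exact ⟨c, rfl, 0, (sub_eq_zero.2 hy.symm).symm⟩
    · exact ⟨0, map_zero _, 0, rfl⟩

end

section

variable {R : Type u} [CommRing R] (I : Ideal R)

lemma one_tmul_eq_zero_iff_mem_smul_top {N : Type v} [AddCommGroup N] [Module R N] (w : N) :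
    (1 : R ⧸ I) ⊗ₜ[R] w = 0 ↔ w ∈ I • (⊤ : Submodule R N) := by
  rw [← (TensorProduct.quotTensorEquivQuotSMul N I).map_eq_zero_iff,
    TensorProduct.quotTensorEquivQuotSMul_mk_one_tmul, Submodule.Quotient.mk_eq_zero]

lemma exists_one_tmul_eq {N : Type v} [AddCommGroup N] [Module R N]
    (t : TensorProduct R (R ⧸ I) N) : ∃ w : N, (1 : R ⧸ I) ⊗ₜ[R] w = t := by
  obtain ⟨x, rfl⟩ := (TensorProduct.quotTensorEquivQuotSMul N I).symm.surjective t
  obtain ⟨w, rfl⟩ := Submodule.Quotient.mk_surjective _ x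
  exact ⟨w, (TensorProduct.quotTensorEquivQuotSMul_symm_mk I w).symm⟩

lemma exactAt_quotient_tensor_iff (K : ChainComplex (ModuleCat.{u} R) ℕ) (i j k : ℕ)
    (hi : (ComplexShape.down ℕ).prev j = i) (hk : (ComplexShape.down ℕ).next j = k) :
    ((((MonoidalCategory.tensoringLeft (ModuleCat.{u} R)).obj
      (ModuleCat.of R (R ⧸ I))).mapHomologicalComplex _).obj K).ExactAt j ↔
      ∀ w : K.X j, (K.d j k).hom w ∈ I • (⊤ : Submodule R (K.X k)) →
        ∃ u, w - (K.d i j).hom u ∈ I • (⊤ : Submodule R (K.X j)) := by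
  rw [HomologicalComplex.exactAt_iff' _ i j k hi hk, ShortComplex.moduleCat_exact_iff]
  constructor
  · intro h w hw
    obtain ⟨t, ht⟩ := h ((1 : R ⧸ I) ⊗ₜ[R] w) ((one_tmul_eq_zero_iff_mem_smul_top I _).2 hw)
    obtain ⟨u, rfl⟩ := exists_one_tmul_eq I t
    refine ⟨u, (one_tmul_eq_zero_iff_mem_smul_top I _).1 ?_⟩
    rw [TensorProduct.tmul_sub, sub_eq_zero]
    exact ht.symm
  · intro h t ht
    obtain ⟨w, rfl⟩ := exists_one_tmul_eq I t
    obtain ⟨u, hu⟩ := h w ((one_tmul_eq_zero_iff_mem_smul_top I _).1 ht)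
    refine ⟨(1 : R ⧸ I) ⊗ₜ[R] u, ?_⟩
    have := (one_tmul_eq_zero_iff_mem_smul_top I _).2 hu
    rw [TensorProduct.tmul_sub, sub_eq_zero] at this
    exact this.symm

lemma tor_isZero_iff_acyclicMod {M : ModuleCat.{u} R} (P : ProjectiveResolution M) :
    (∀ n : ℕ, IsZero (((Tor (ModuleCat.{u} R) n).obj (ModuleCat.of R (R ⧸ I))).obj M)) ↔
      (LinearComplex.ofChain P.complex).AcyclicMod I := by
  have key : ∀ n : ℕ, IsZero (((Tor (ModuleCat.{u} R) n).obj (ModuleCat.of R (R ⧸ I))).obj M) ↔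
      ((((MonoidalCategory.tensoringLeft (ModuleCat.{u} R)).obj
        (ModuleCat.of R (R ⧸ I))).mapHomologicalComplex _).obj P.complex).ExactAt n := fun n ↦
    (P.isoLeftDerivedObj _ n).isZero_iff.trans
      (HomologicalComplex.exactAt_iff_isZero_homology _ _).symm
  simp only [key]
  constructor
  · rintro h ((_ | k) | (_ | _ | k)) c hc
    · exact ⟨0, zero_mem _⟩
    · exact ⟨0, zero_mem _⟩
    · refine (exactAt_quotient_tensor_iff I P.complex 1 0 0 (by simp) (by simp)).1 (h 0) c ?_
      rw [P.complex.shape 0 0 (by simp)]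
      exact zero_mem _
    · exact (exactAt_quotient_tensor_iff I P.complex 2 1 0 (by simp) (by simp)).1 (h 1) c hc
    · exact (exactAt_quotient_tensor_iff I P.complex (k + 3) (k + 2) (k + 1)
        (by simp) (by simp)).1 (h _) c hc
  · rintro h (_ | _ | k)
    · exact (exactAt_quotient_tensor_iff I P.complex 1 0 0 (by simp) (by simp)).2
        fun w _ ↦ h (Int.negSucc 0) w (zero_mem _)
    · exact (exactAt_quotient_tensor_iff I P.complex 2 1 0 (by simp) (by simp)).2
        fun w hw ↦ h (Int.negSucc 1) w hw
    · exact (exactAt_quotient_tensor_iff I P.complex (k + 3) (k + 2) (k + 1)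
        (by simp) (by simp)).2 fun w hw ↦ h (Int.negSucc (k + 2)) w hw

end

section

variable {R : Type u} [CommRing R]

lemma isZero_ext_succ_iff {X Y : ModuleCat.{u} R} (n : ℕ) :
    IsZero (((Ext R (ModuleCat.{u} R) (n + 1)).obj (Opposite.op X)).obj Y) ↔
      Subsingleton (Abelian.Ext X Y (n + 1)) := by
  let Q := projectiveResolution X
  rw [(Q.isoExt (R := R) (n + 1) Y).isZero_iff,
    ← HomologicalComplex.exactAt_iff_isZero_homology,
    HomologicalComplex.exactAt_iff' _ n (n + 1) (n + 2) (by simp) (by simp),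
    ShortComplex.moduleCat_exact_iff]
  constructor
  · refine fun h ↦ subsingleton_of_forall_eq 0 fun α ↦ ?_
    obtain ⟨f, hf, rfl⟩ := Q.extMk_surjective α (n + 2) rfl
    exact (Q.extMk_eq_zero_iff f (n + 2) rfl hf n rfl).2 (h f hf)
  · intro h f hf
    exact (Q.extMk_eq_zero_iff f (n + 2) rfl hf n rfl).1 (Subsingleton.elim _ _)

lemma isZero_ext_zero_iff {X Y : ModuleCat.{u} R} :
    IsZero (((Ext R (ModuleCat.{u} R) 0).obj (Opposite.op X)).obj Y) ↔
      ∀ f : X ⟶ Y, f = 0 := by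
  let Q := projectiveResolution X
  rw [(Q.isoExt (R := R) 0 Y).isZero_iff,
    ← HomologicalComplex.exactAt_iff_isZero_homology,
    HomologicalComplex.exactAt_iff' _ 0 0 1 (by simp) (by simp),
    ShortComplex.moduleCat_exact_iff]
  constructor
  · intro h f
    let π : Q.complex.X 0 ⟶ X := Q.π.f 0
    have : Epi π := inferInstanceAs (Epi (Q.π.f 0))
    obtain ⟨g, hg⟩ := h (π ≫ f)
      ((Q.complex_d_comp_π_f_zero_assoc f).trans zero_comp)
    have hd (g : Q.complex.X 0 ⟶ Y) : Q.complex.d 0 0 ≫ g = 0 := by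
      rw [Q.complex.shape 0 0 (by simp), zero_comp]
    exact zero_of_epi_comp π (hg.symm.trans (hd g))
  · intro h f hf
    refine ⟨0, ?_⟩
    rw [map_zero]
    obtain ⟨g, hg⟩ : ∃ g : X ⟶ Y, (Q.π.f 0 : Q.complex.X 0 ⟶ X) ≫ g = f :=
      ⟨_, Q.exact₀.g_desc (f : Q.complex.X 0 ⟶ Y) hf⟩
    rw [h g] at hg
    exact comp_zero.symm.trans hg

lemma subsingleton_ext_succ_iff {X Y : ModuleCat.{u} R} (J : InjectiveResolution Y) (n : ℕ) :
    Subsingleton (Abelian.Ext X Y (n + 1)) ↔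
      ∀ f : X ⟶ J.cocomplex.X (n + 1), f ≫ J.cocomplex.d (n + 1) (n + 2) = 0 →
        ∃ g : X ⟶ J.cocomplex.X n, g ≫ J.cocomplex.d n (n + 1) = f := by
  constructor
  · intro h f hf
    exact (J.extMk_eq_zero_iff f (n + 2) rfl hf n rfl).1 (Subsingleton.elim _ _)
  · refine fun h ↦ subsingleton_of_forall_eq 0 fun α ↦ ?_
    obtain ⟨f, hf, rfl⟩ := J.extMk_surjective α (n + 2) rfl
    exact (J.extMk_eq_zero_iff f (n + 2) rfl hf n rfl).2 (h f hf)

variable (I : Ideal R)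

lemma smul_apply_one_eq_zero {N : Type v} [AddCommGroup N] [Module R N] (f : (R ⧸ I) →ₗ[R] N)
    {x : R} (hx : x ∈ I) : x • f 1 = 0 := by
  rw [← map_smul, Algebra.smul_def, mul_one, Ideal.Quotient.algebraMap_eq,
    Ideal.Quotient.eq_zero_iff_mem.2 hx, map_zero]

lemma exists_apply_one_eq {N : Type v} [AddCommGroup N] [Module R N] (z : N)
    (hz : ∀ x ∈ I, x • z = 0) : ∃ f : (R ⧸ I) →ₗ[R] N, f 1 = z :=
  ⟨Submodule.liftQ I (LinearMap.toSpanSingleton R N z) fun x hx ↦ hz x hx, one_smul R z⟩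

lemma quotient_linearMap_ext {N : Type v} [AddCommGroup N] [Module R N]
    {f g : (R ⧸ I) →ₗ[R] N} (h : f 1 = g 1) : f = g := by
  ext
  exact h

lemma ext_isZero_iff_acyclicTorsion {M : ModuleCat.{u} R} (J : InjectiveResolution M) :
    (∀ n : ℕ, IsZero (((Ext R (ModuleCat.{u} R) n).obj
      (Opposite.op (ModuleCat.of R (R ⧸ I)))).obj M)) ↔
      (LinearComplex.ofCochain J.cocomplex).AcyclicTorsion I := by
  have hιi : Function.Injective (J.ι.f 0).hom := (ModuleCat.mono_iff_injective _).1 inferInstance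
  have zero : IsZero (((Ext R (ModuleCat.{u} R) 0).obj
      (Opposite.op (ModuleCat.of R (R ⧸ I)))).obj M) ↔
      ∀ z : J.cocomplex.X 0, (∀ x ∈ I, x • z = 0) → (J.cocomplex.d 0 1).hom z = 0 → z = 0 := by
    rw [isZero_ext_zero_iff]
    constructor
    · intro h z hz hd
      obtain ⟨m, rfl⟩ := injectiveResolution_exact_zero J z hd
      obtain ⟨f, rfl⟩ := exists_apply_one_eq I m fun x hx ↦ hιi (by
        rw [map_smul, map_zero, hz x hx])
      have : f = 0 := congr($(h (ModuleCat.ofHom f)).hom)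
      rw [this, LinearMap.zero_apply, map_zero]
    · intro h f
      refine ModuleCat.hom_ext (quotient_linearMap_ext I (hιi ?_))
      refine (h _ (fun x hx ↦ ?_) congr($(J.ι_f_zero_comp_complex_d).hom (f.hom 1))).trans
        (map_zero _).symm
      exact smul_apply_one_eq_zero I ((J.ι.f 0).hom ∘ₗ f.hom) hx
  have succ : ∀ n, IsZero (((Ext R (ModuleCat.{u} R) (n + 1)).obj
      (Opposite.op (ModuleCat.of R (R ⧸ I)))).obj M) ↔
      ∀ z : J.cocomplex.X (n + 1), (∀ x ∈ I, x • z = 0) →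
        (J.cocomplex.d (n + 1) (n + 2)).hom z = 0 →
        ∃ b : J.cocomplex.X n, (∀ x ∈ I, x • b = 0) ∧ (J.cocomplex.d n (n + 1)).hom b = z := by
    intro n
    rw [isZero_ext_succ_iff, subsingleton_ext_succ_iff J]
    constructor
    · intro h z hz hd
      obtain ⟨f, rfl⟩ := exists_apply_one_eq I z hz
      obtain ⟨g, hg⟩ := h (ModuleCat.ofHom f)
        (ModuleCat.hom_ext (quotient_linearMap_ext I hd))
      exact ⟨g.hom 1, fun x ↦ smul_apply_one_eq_zero I g.hom, congr($(hg).hom 1)⟩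
    · intro h f hf
      obtain ⟨b, hb, hd⟩ := h (f.hom 1) (fun x ↦ smul_apply_one_eq_zero I f.hom)
        congr($(hf).hom 1)
      obtain ⟨g, rfl⟩ := exists_apply_one_eq I b hb
      exact ⟨ModuleCat.ofHom g, ModuleCat.hom_ext (quotient_linearMap_ext I hd)⟩
  constructor
  · rintro h (k | (_ | k)) c hI hc
    · exact (succ k).1 (h _) c hI hc
    · exact ⟨0, fun _ _ ↦ smul_zero _, (zero.1 (h 0) c hI hc).symm⟩
    · exact ⟨0, fun _ _ ↦ smul_zero _, rfl⟩
  · rintro h (_ | k)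
    · refine zero.2 fun z hz hd ↦ ?_
      obtain ⟨b, -, hb⟩ := h (Int.negSucc 0) z hz hd
      exact hb.symm
    · exact (succ k).2 fun z hz hd ↦ h (Int.ofNat k) z hz hd

end

/-- Let `R` be a commutative ring, `I` a finitely generated ideal of `R`,
and `M` an `R`-module. Then `Tor_n^R(R/I, M) = 0` for all `n ≥ 0` if and only if
`Ext_R^n(R/I, M) = 0` for all `n ≥ 0`. -/
theorem tor_vanishing_iff_ext_vanishing {R : Type} [CommRing R] (I : Ideal R) (hI : I.FG)
    (M : Type) [AddCommGroup M] [Module R M] :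
    (∀ n : ℕ,
      IsZero (((Tor (ModuleCat R) n).obj (ModuleCat.of R (R ⧸ I))).obj (ModuleCat.of R M))) ↔
    (∀ n : ℕ,
      IsZero (((Ext R (ModuleCat R) n).obj
        (Opposite.op (ModuleCat.of R (R ⧸ I)))).obj (ModuleCat.of R M))) := by
  have P := projectiveResolution (ModuleCat.of R M)
  have J := injectiveResolution (ModuleCat.of R M)
  rw [tor_isZero_iff_acyclicMod I P, ext_isZero_iff_acyclicTorsion I J]
  exact (hasQuasiIso_ofChain_ofCochain P J).acyclicMod_iff_acyclicTorsion
    (isBoundedProjective_ofChain P) (isBoundedInjective_ofCochain J) hI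
end

section
/- Let R be a commutative ring, I a finitely generated ideal of R, and M an R-module. Let P₁ →^d P₀ →^π M → 0 be an exact sequence of R-modules with P₀ and P₁ projective, and let L₀ := coker(d^∧_I : (P₁)^∧_I → (P₀)^∧_I) with quotient map q : (P₀)^∧_I → L₀. Then: (1) there is a unique R-linear map η : M → L₀ with η ∘ π = q ∘ γ_{P₀}; (2) the R-linear map ε : L₀ → M^∧_I induced by π^∧_I : (P₀)^∧_I → M^∧_I satisfies ε ∘ η = γ_M; and (3) ε is surjective. -/
/-- Let `R` be a commutative ring, `I` a finitely generated ideal of `R`,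
and `M` an `R`-module. Let `P₁ →^d P₀ →^π M → 0` be an exact sequence of `R`-modules with
`P₀`, `P₁` projective, and let `L₀ := coker(d^∧_I)` with quotient map
`q : (P₀)^∧_I → L₀`. Then:
(1) there is a unique `R`-linear `η : M → L₀` with `η ∘ π = q ∘ γ_{P₀}`;
(2) the `R`-linear map `ε : L₀ → M^∧_I` induced by `π^∧_I` (i.e. the unique map with
`ε ∘ q = π^∧_I`) satisfies `ε ∘ η = γ_M`; and
(3) `ε` is surjective. -/
theorem lZero_factorization {R : Type*} [CommRing R] (I : Ideal R) (hI : I.FG)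
    (M P₀ P₁ : Type*) [AddCommGroup M] [Module R M] [AddCommGroup P₀] [Module R P₀]
    [AddCommGroup P₁] [Module R P₁] [Module.Projective R P₀] [Module.Projective R P₁]
    (d : P₁ →ₗ[R] P₀) (π : P₀ →ₗ[R] M)
    (hexact : Function.Exact d π) (hsurj : Function.Surjective π) :
    ∀ q : AdicCompletion I P₀ →ₗ[R]
        (AdicCompletion I P₀ ⧸
          LinearMap.range ((AdicCompletion.map I d).restrictScalars R)),
      q = (LinearMap.range ((AdicCompletion.map I d).restrictScalars R)).mkQ →
      (∃! η : M →ₗ[R]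
          (AdicCompletion I P₀ ⧸
            LinearMap.range ((AdicCompletion.map I d).restrictScalars R)),
        η.comp π = q.comp (AdicCompletion.of I P₀)) ∧
      (∃! ε : (AdicCompletion I P₀ ⧸
            LinearMap.range ((AdicCompletion.map I d).restrictScalars R)) →ₗ[R]
          AdicCompletion I M,
        ε.comp q = (AdicCompletion.map I π).restrictScalars R) ∧
      (∀ (η : M →ₗ[R]
            (AdicCompletion I P₀ ⧸
              LinearMap.range ((AdicCompletion.map I d).restrictScalars R)))
          (ε : (AdicCompletion I P₀ ⧸
              LinearMap.range ((AdicCompletion.map I d).restrictScalars R)) →ₗ[R]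
            AdicCompletion I M),
        η.comp π = q.comp (AdicCompletion.of I P₀) →
        ε.comp q = (AdicCompletion.map I π).restrictScalars R →
        ε.comp η = AdicCompletion.of I M ∧ Function.Surjective ε) := by
  rintro q rfl
  have hcomp : π ∘ₗ d = 0 := hexact.linearMap_comp_eq_zero
  set S := LinearMap.range ((AdicCompletion.map I d).restrictScalars R)
  have hker : LinearMap.ker π ≤ LinearMap.ker (S.mkQ.comp (AdicCompletion.of I P₀)) := by
    intro x hx
    obtain ⟨y, rfl⟩ := (hexact x).1 hx
    rw [LinearMap.mem_ker, LinearMap.comp_apply, Submodule.mkQ_apply,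
      Submodule.Quotient.mk_eq_zero]
    exact ⟨AdicCompletion.of I P₁ y, AdicCompletion.map_of I d y⟩
  have hrange : S ≤ LinearMap.ker ((AdicCompletion.map I π).restrictScalars R) := by
    rintro _ ⟨y, rfl⟩
    change (AdicCompletion.map I π ∘ₗ AdicCompletion.map I d) y = 0
    rw [AdicCompletion.map_comp, hcomp, AdicCompletion.map_zero, LinearMap.zero_apply]
  refine ⟨?_, ⟨S.liftQ _ hrange, S.liftQ_mkQ _ hrange, fun ε hε => ?_⟩,
    fun η ε hη hε => ⟨?_, fun z => ?_⟩⟩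
  · let e := π.quotKerEquivOfSurjective hsurj
    have he : ((LinearMap.ker π).liftQ _ hker ∘ₗ e.symm.toLinearMap) ∘ₗ π =
        S.mkQ ∘ₗ AdicCompletion.of I P₀ := by
      ext x
      have hx : e.symm (π x) = (LinearMap.ker π).mkQ x := (LinearEquiv.symm_apply_eq e).2 rfl
      simp [hx]
    exact ⟨_, he, fun η hη => (LinearMap.cancel_right hsurj).1 (hη.trans he.symm)⟩
  · rw [← LinearMap.cancel_right S.mkQ_surjective, hε, S.liftQ_mkQ]
  · rw [← LinearMap.cancel_right hsurj, LinearMap.comp_assoc, hη, ← LinearMap.comp_assoc, hε]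
    exact LinearMap.ext fun x => AdicCompletion.map_of I π x
  · obtain ⟨w, rfl⟩ := AdicCompletion.map_surjective I hsurj z
    exact ⟨S.mkQ w, LinearMap.congr_fun hε w⟩
end

section
/- Let S be a commutative ring and let I and J be finitely generated ideals of S with √I = √J. Then for every S-module M there is an S-linear isomorphism φ_M : M^∧_I → M^∧_J satisfying φ_M ∘ γ^I_M = γ^J_M, where γ^I_M : M → M^∧_I and γ^J_M : M → M^∧_J are the canonical maps. In other words, I-adic and J-adic completion agree. -/
namespace AdicCompletion

variable {S : Type*} [CommRing S] {I J : Ideal S} {M : Type*} [AddCommGroup M] [Module S M]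

/-- The image in `M ⧸ p` of a component of `x` does not depend on the component. -/
theorem factor_val_eq_factor_val (x : AdicCompletion I M) {p : Submodule S M} {a b : ℕ}
    (ha : I ^ a • ⊤ ≤ p) (hb : I ^ b • ⊤ ≤ p) :
    Submodule.factor ha (x.val a) = Submodule.factor hb (x.val b) := by
  wlog hab : a ≤ b generalizing a b
  · exact (this hb ha (le_of_not_ge hab)).symm
  rw [← x.property hab]
  exact Submodule.factor_comp_apply _ _ _

theorem pow_mul_smul_top_le {k : ℕ} (h : I ^ k ≤ J) (n : ℕ) :
    (I ^ (k * n) • ⊤ : Submodule S M) ≤ J ^ n • ⊤ :=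
  Submodule.smul_mono_left (pow_mul I k n ▸ Ideal.pow_right_mono h n)

variable (M) in
/-- The map from the `I`-adic to the `J`-adic completion when `J` contains a power of `I`. -/
noncomputable def mapOfPowLE {k : ℕ} (h : I ^ k ≤ J) :
    AdicCompletion I M →ₗ[S] AdicCompletion J M :=
  lift J (fun n ↦ Submodule.factor (pow_mul_smul_top_le h n) ∘ₗ eval I M (k * n))
    fun {m n} hmn ↦ by
      refine LinearMap.ext fun x ↦ ?_
      exact (Submodule.factor_comp_apply (pow_mul_smul_top_le h n)
        (Submodule.pow_smul_top_le J M hmn) _).trans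
        (factor_val_eq_factor_val x _ (pow_mul_smul_top_le h m))

theorem mapOfPowLE_val {k : ℕ} (h : I ^ k ≤ J) (x : AdicCompletion I M) (n : ℕ) :
    (mapOfPowLE M h x).val n = Submodule.factor (pow_mul_smul_top_le h n) (x.val (k * n)) :=
  rfl

theorem mapOfPowLE_comp_of {k : ℕ} (h : I ^ k ≤ J) :
    mapOfPowLE M h ∘ₗ of I M = of J M := by
  ext x n
  exact Submodule.factor_mk (pow_mul_smul_top_le h n) x

theorem mapOfPowLE_mapOfPowLE {k l : ℕ} (h : I ^ k ≤ J) (h' : J ^ l ≤ I)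
    (x : AdicCompletion I M) : mapOfPowLE M h' (mapOfPowLE M h x) = x := by
  ext n
  rw [mapOfPowLE_val, mapOfPowLE_val]
  refine (Submodule.factor_comp_apply _ _ _).trans
    ((factor_val_eq_factor_val x _ le_rfl).trans ?_)
  obtain ⟨y, hy⟩ := Submodule.Quotient.mk_surjective _ (x.val n)
  rw [← hy]
  rfl

end AdicCompletion

/-- Let `S` be a commutative ring and let `I` and `J` be finitely
generated ideals of `S` with `√I = √J`. Then for every `S`-module `M` there is an
`S`-linear isomorphism `φ_M : M^∧_I → M^∧_J` compatible with the canonical maps. -/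
theorem adicCompletion_congr_of_radical_eq {S : Type*} [CommRing S] (I J : Ideal S)
    (hI : I.FG) (hJ : J.FG) (h : I.radical = J.radical)
    (M : Type*) [AddCommGroup M] [Module S M] :
    ∃ φ : AdicCompletion I M ≃ₗ[S] AdicCompletion J M,
      (φ : AdicCompletion I M →ₗ[S] AdicCompletion J M).comp (AdicCompletion.of I M) =
        AdicCompletion.of J M := by
  obtain ⟨k, hk⟩ := Ideal.exists_pow_le_of_le_radical_of_fg (Ideal.le_radical.trans h.le) hI
  obtain ⟨l, hl⟩ := Ideal.exists_pow_le_of_le_radical_of_fg (Ideal.le_radical.trans h.ge) hJ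
  exact ⟨.ofLinearMap (AdicCompletion.mapOfPowLE M hk) (AdicCompletion.mapOfPowLE M hl)
    (LinearMap.ext (AdicCompletion.mapOfPowLE_mapOfPowLE hl hk))
    (LinearMap.ext (AdicCompletion.mapOfPowLE_mapOfPowLE hk hl)),
    AdicCompletion.mapOfPowLE_comp_of hk⟩
end

section
/- Let θ : R → S be a homomorphism of commutative rings, let I be a finitely generated ideal of R and J a finitely generated ideal of S with √(I·S) = √J, where I·S denotes the extension of I along θ. Then for every S-module M there is an R-linear isomorphism ψ_M : (θ^*M)^∧_I → θ^*(M^∧_J) satisfying ψ_M ∘ γ^I_{θ^*M} = θ^*(γ^J_M), where θ^* denotes restriction of scalars along θ. That is, the I-adic completion of M regarded as an R-module is naturally isomorphic to the underlying R-module of the J-adic completion of M. -/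
namespace AdicCompletion

section ComparisonOfFiltrations

variable {R S M : Type*} [CommRing R] [CommRing S] [Algebra R S] {I : Ideal R} {J : Ideal S}
  [AddCommGroup M] [Module S M] [Module R M] [IsScalarTower R S M]

/-- The map between adic completions of an `S`-module over `R` and over `S`, induced by inclusions
`I ^ c n • M ⊆ J ^ n • M` for a monotone function `c`. -/
def ofPowSMulLE {c : ℕ → ℕ} (hc : Monotone c)
    (hIJ : ∀ n, (I ^ c n • ⊤ : Submodule R M) ≤
      (J ^ n • ⊤ : Submodule S M).restrictScalars R) :
    AdicCompletion I M →ₗ[R] AdicCompletion J M where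
  toFun x := ⟨fun n ↦ Submodule.liftQ (I ^ c n • ⊤ : Submodule R M)
      ((Submodule.mkQ (J ^ n • ⊤ : Submodule S M)).restrictScalars R)
      (fun a ha ↦ (Submodule.Quotient.mk_eq_zero _).2 (hIJ n ha)) (x.val (c n)), by
    intro m n hmn
    induction x using AdicCompletion.induction_on with | _ a
    exact (Submodule.Quotient.eq _).2
      (hIJ m ((Submodule.Quotient.eq _).1 (a.mk_eq_mk (hc hmn))))⟩
  map_add' x y := AdicCompletion.ext fun n ↦ map_add _ (x.val (c n)) (y.val (c n))
  map_smul' r x := AdicCompletion.ext fun n ↦ map_smul _ r (x.val (c n))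

theorem ofPowSMulLE_mk_val {c : ℕ → ℕ} (hc : Monotone c)
    (hIJ : ∀ n, (I ^ c n • ⊤ : Submodule R M) ≤
      (J ^ n • ⊤ : Submodule S M).restrictScalars R) (a : AdicCauchySequence I M) (n : ℕ) :
    (ofPowSMulLE hc hIJ (mk I M a)).val n = Submodule.Quotient.mk (a (c n)) :=
  rfl

theorem ofPowSMulLE_of {c : ℕ → ℕ} (hc : Monotone c)
    (hIJ : ∀ n, (I ^ c n • ⊤ : Submodule R M) ≤
      (J ^ n • ⊤ : Submodule S M).restrictScalars R) (m : M) :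
    ofPowSMulLE hc hIJ (of I M m) = of J M m :=
  rfl

theorem ofPowSMulLE_bijective {c d : ℕ → ℕ} (hc : StrictMono c) (hd : StrictMono d)
    (hIJ : ∀ n, (I ^ c n • ⊤ : Submodule R M) ≤
      (J ^ n • ⊤ : Submodule S M).restrictScalars R)
    (hJI : ∀ n, (J ^ d n • ⊤ : Submodule S M).restrictScalars R ≤
      (I ^ n • ⊤ : Submodule R M)) :
    Function.Bijective (ofPowSMulLE hc.monotone hIJ) := by
  constructor
  · refine (injective_iff_map_eq_zero _).2 fun x hx ↦ ?_
    induction x using AdicCompletion.induction_on with | _ a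
    ext n
    have hmem : a (c (d n)) ∈ (J ^ d n • ⊤ : Submodule S M) := by
      rw [← Submodule.Quotient.mk_eq_zero, ← ofPowSMulLE_mk_val hc.monotone hIJ, hx]
      rfl
    exact (a.mk_eq_mk ((hd.id_le n).trans (hc.id_le _))).symm.trans
      ((Submodule.Quotient.mk_eq_zero _).2 (hJI n hmem))
  · intro y
    induction y using AdicCompletion.induction_on with | _ b
    refine ⟨mk I M ⟨fun n ↦ b (d n), fun {m n} hmn ↦ ?_⟩, ?_⟩
    · exact ((Submodule.Quotient.eq _).2
        (hJI m ((Submodule.Quotient.eq _).1 (b.mk_eq_mk (hd.monotone hmn))))).symm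
    · ext n
      exact b.mk_eq_mk ((hc.id_le n).trans (hd.id_le _))

end ComparisonOfFiltrations

end AdicCompletion

theorem Ideal.exists_pos_pow_mul_le_of_le_radical {S : Type*} [CommSemiring S] {I J : Ideal S}
    (hI : I.FG) (h : I ≤ J.radical) : ∃ k, 0 < k ∧ ∀ n, I ^ (k * n) ≤ J ^ n := by
  obtain ⟨k, hk⟩ := Ideal.exists_pow_le_of_le_radical_of_fg h hI
  refine ⟨k + 1, k.succ_pos, fun n ↦ ?_⟩
  rw [pow_mul]
  exact Ideal.pow_right_mono ((Ideal.pow_le_pow_right k.le_succ).trans hk) n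


/-- Let `θ : R → S` be a homomorphism of commutative rings (encoded as an
`Algebra R S` instance with `θ = algebraMap R S`), let `I` be a finitely generated ideal of
`R` and `J` a finitely generated ideal of `S` with `√(I·S) = √J`. Then for every `S`-module
`M` (with its restricted `R`-module structure) there is an `R`-linear isomorphism
`ψ_M : (θ^*M)^∧_I → θ^*(M^∧_J)` compatible with the canonical maps `γ^I` and `γ^J`. -/
theorem adicCompletion_restrictScalars {R S : Type*} [CommRing R] [CommRing S] [Algebra R S]
    (I : Ideal R) (J : Ideal S) (hI : I.FG) (hJ : J.FG)
    (h : (I.map (algebraMap R S)).radical = J.radical)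
    (M : Type*) [AddCommGroup M] [Module S M] [Module R M] [IsScalarTower R S M] :
    ∃ ψ : AdicCompletion I M ≃ₗ[R] RestrictScalars R S (AdicCompletion J M),
      ∀ m : M, ψ (AdicCompletion.of I M m) = AdicCompletion.of J M m := by
  have hmap (n : ℕ) : (I ^ n • ⊤ : Submodule R M) =
      ((I.map (algebraMap R S)) ^ n • ⊤ : Submodule S M).restrictScalars R := by
    rw [← Ideal.map_pow, Submodule.restrictScalars_map_smul_eq, Submodule.restrictScalars_top]
  obtain ⟨k, hk, hIJ⟩ := Ideal.exists_pos_pow_mul_le_of_le_radical (hI.map (algebraMap R S))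
    (Ideal.le_radical.trans h.le)
  obtain ⟨l, hl, hJI⟩ := Ideal.exists_pos_pow_mul_le_of_le_radical hJ
    (Ideal.le_radical.trans h.ge)
  have hc : StrictMono (k * ·) := strictMono_mul_left_of_pos hk
  have hd : StrictMono (l * ·) := strictMono_mul_left_of_pos hl
  have hIJ' (n : ℕ) : (I ^ (k * n) • ⊤ : Submodule R M) ≤
      (J ^ n • ⊤ : Submodule S M).restrictScalars R := by
    rw [hmap]
    exact (Submodule.restrictScalars_le R).2 (Submodule.smul_mono_left (hIJ n))
  have hJI' (n : ℕ) : (J ^ (l * n) • ⊤ : Submodule S M).restrictScalars R ≤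
      (I ^ n • ⊤ : Submodule R M) := by
    rw [hmap]
    exact (Submodule.restrictScalars_le R).2 (Submodule.smul_mono_left (hJI n))
  let φ := AdicCompletion.ofPowSMulLE hc.monotone hIJ'
  let ψ : AdicCompletion I M →ₗ[R] RestrictScalars R S (AdicCompletion J M) :=
    { toFun := φ
      map_add' := map_add φ
      map_smul' r x := (map_smul φ r x).trans (algebraMap_smul S r (φ x)).symm }
  exact ⟨LinearEquiv.ofBijective ψ (AdicCompletion.ofPowSMulLE_bijective hc hd hIJ' hJI'),
    AdicCompletion.ofPowSMulLE_of hc.monotone hIJ'⟩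
end
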